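/- Let R = (E,φ) be a nonzero representation of a finite quiver Q on finite-dimensional complex inner product spaces whose inner products satisfy the (σ,τ)-vortex equations. If R is indecomposable, i.e. there is no internal direct sum decomposition E_v = E'_v ⊕ E''_v (for all v ∈ Q₀) into two nonzero subrepresentations R' and R'', then R is (σ,τ)-stable: μ_{σ,τ}(R') < μ_{σ,τ}(R) for every nonzero proper subrepresentation R'. -/

import Mathlib

open scoped InnerProductSpace

noncomputable section

variable {Q0 Q1 : Type} [DecidableEq Q0] [Fintype Q0] [Fintype Q1]
variable (t h : Q1 → Q0)
variable (E : Q0 → Type) [∀ v, NormedAddCommGroup (E v)]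
  [∀ v, InnerProductSpace ℂ (E v)] [∀ v, FiniteDimensional ℂ (E v)]
variable (φ : ∀ a, E (t a) →ₗ[ℂ] E (h a))

/-- The moment-map/vortex operator at a vertex `v`:
`∑_{a ∈ h⁻¹(v)} φ_a ∘ φ_a* − ∑_{a ∈ t⁻¹(v)} φ_a* ∘ φ_a`. -/
def vortexOp (v : Q0) : E v →ₗ[ℂ] E v :=
  (∑ a : Q1, if hav : h a = v then hav ▸ (φ a ∘ₗ LinearMap.adjoint (φ a)) else 0)
  - ∑ a : Q1, if hav : t a = v then hav ▸ (LinearMap.adjoint (φ a) ∘ₗ φ a) else 0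

/-- The (σ,τ)-vortex equations over a point (the curvature terms vanish). -/
def SatisfiesVortex (τ : Q0 → ℝ) : Prop :=
  ∀ v, vortexOp t h E φ v = (τ v : ℂ) • LinearMap.id

/-- A family of subspaces is a subrepresentation if it is preserved by all the maps `φ_a`. -/
def IsSubrep (U : ∀ v, Submodule ℂ (E v)) : Prop :=
  ∀ a, ∀ x ∈ U (t a), φ a x ∈ U (h a)

/-- The (σ,τ)-degree of a family of subspaces: `−∑_v τ_v dim_ℂ U_v`. -/
def degST (τ : Q0 → ℝ) (U : ∀ v, Submodule ℂ (E v)) : ℝ :=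
  - ∑ v, τ v * (Module.finrank ℂ (U v) : ℝ)

/-- The (σ,τ)-slope of a family of subspaces. -/
def slopeST (σ τ : Q0 → ℝ) (U : ∀ v, Submodule ℂ (E v)) : ℝ :=
  degST E τ U / ∑ v, σ v * (Module.finrank ℂ (U v) : ℝ)

/-- (σ,τ)-stability: every nonzero proper subrepresentation has strictly smaller slope. -/
def IsStable (σ τ : Q0 → ℝ) : Prop :=
  ∀ U : ∀ v, Submodule ℂ (E v), IsSubrep t h E φ U →
    (∃ v, U v ≠ ⊥) → (∃ v, U v ≠ ⊤) →
    slopeST E σ τ U < slopeST E σ τ (fun v => (⊤ : Submodule ℂ (E v)))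

section Trace

variable {V W : Type*} [NormedAddCommGroup V] [InnerProductSpace ℂ V] [FiniteDimensional ℂ V]
  [NormedAddCommGroup W] [InnerProductSpace ℂ W] [FiniteDimensional ℂ W]

theorem trace_adjoint_comp_self_eq_sum (B : V →ₗ[ℂ] W) :
    LinearMap.trace ℂ V (LinearMap.adjoint B ∘ₗ B) =
      ((∑ i, ‖B (stdOrthonormalBasis ℂ V i)‖ ^ 2 : ℝ) : ℂ) := by
  rw [LinearMap.trace_eq_sum_inner _ (stdOrthonormalBasis ℂ V)]
  push_cast
  refine Finset.sum_congr rfl fun i _ => ?_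
  rw [Function.comp_apply, LinearMap.adjoint_inner_right, inner_self_eq_norm_sq_to_K]
  rfl

theorem re_trace_adjoint_comp_self_nonneg (B : V →ₗ[ℂ] W) :
    0 ≤ (LinearMap.trace ℂ V (LinearMap.adjoint B ∘ₗ B)).re := by
  rw [trace_adjoint_comp_self_eq_sum, Complex.ofReal_re]
  positivity

theorem eq_zero_of_re_trace_adjoint_comp_self_eq_zero {B : V →ₗ[ℂ] W}
    (hB : (LinearMap.trace ℂ V (LinearMap.adjoint B ∘ₗ B)).re = 0) : B = 0 := by
  rw [trace_adjoint_comp_self_eq_sum, Complex.ofReal_re,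
    Finset.sum_eq_zero_iff_of_nonneg (fun _ _ => by positivity)] at hB
  refine (stdOrthonormalBasis ℂ V).toBasis.ext fun i => ?_
  simpa using hB i (Finset.mem_univ i)

/-- The orthogonal projection onto a subspace, as a linear map. -/
def orthProj (U : Submodule ℂ V) : V →ₗ[ℂ] V := U.starProjection.toLinearMap

theorem trace_orthProj (U : Submodule ℂ V) :
    LinearMap.trace ℂ V (orthProj U) = Module.finrank ℂ U :=
  LinearMap.IsProj.trace
    ⟨fun x => U.starProjection_apply_mem x, fun _ hx => U.starProjection_eq_self_iff.2 hx⟩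

theorem orthProj_comp_self (U : Submodule ℂ V) : orthProj U ∘ₗ orthProj U = orthProj U :=
  ContinuousLinearMap.IsIdempotentElem.toLinearMap U.isIdempotentElem_starProjection

theorem adjoint_orthProj (U : Submodule ℂ V) :
    LinearMap.adjoint (orthProj U) = orthProj U :=
  ((LinearMap.eq_adjoint_iff _ _).2 fun x y => U.starProjection_isSymmetric x y).symm

theorem orthProj_comp_comp_orthProj {f : V →ₗ[ℂ] W} {U : Submodule ℂ V} {U' : Submodule ℂ W}
    (hf : ∀ x ∈ U, f x ∈ U') : orthProj U' ∘ₗ f ∘ₗ orthProj U = f ∘ₗ orthProj U :=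
  LinearMap.ext fun x => U'.starProjection_eq_self_iff.2 (hf _ (U.starProjection_apply_mem x))

/-- The second fundamental form of `f` with respect to subspaces `U` and `U'`: the component of
`f` from `Uᗮ` to `U'`. -/
def secondFundamentalForm (f : V →ₗ[ℂ] W) (U : Submodule ℂ V) (U' : Submodule ℂ W) :
    V →ₗ[ℂ] W :=
  orthProj U' ∘ₗ f ∘ₗ (LinearMap.id - orthProj U)

theorem trace_adjoint_comp_secondFundamentalForm {f : V →ₗ[ℂ] W} {U : Submodule ℂ V}
    {U' : Submodule ℂ W} (hf : ∀ x ∈ U, f x ∈ U') :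
    LinearMap.trace ℂ V (LinearMap.adjoint (secondFundamentalForm f U U') ∘ₗ
        secondFundamentalForm f U U') =
      LinearMap.trace ℂ W (orthProj U' ∘ₗ f ∘ₗ LinearMap.adjoint f) -
        LinearMap.trace ℂ V (orthProj U ∘ₗ LinearMap.adjoint f ∘ₗ f) := by
  have hP : (LinearMap.id - orthProj U) ∘ₗ (LinearMap.id - orthProj U) =
      LinearMap.id - orthProj U := by
    simp [LinearMap.comp_sub, LinearMap.sub_comp, orthProj_comp_self]
  have hadj : LinearMap.adjoint (LinearMap.id - orthProj U) = LinearMap.id - orthProj U := by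
    rw [map_sub, adjoint_orthProj, LinearMap.adjoint_id]
  calc
    _ = LinearMap.trace ℂ V ((LinearMap.id - orthProj U) ∘ₗ (LinearMap.adjoint f ∘ₗ
          (orthProj U' ∘ₗ orthProj U') ∘ₗ f ∘ₗ (LinearMap.id - orthProj U))) := by
      simp only [secondFundamentalForm, LinearMap.adjoint_comp, hadj, adjoint_orthProj,
        LinearMap.comp_assoc]
    _ = LinearMap.trace ℂ V (LinearMap.adjoint f ∘ₗ orthProj U' ∘ₗ f ∘ₗ
          ((LinearMap.id - orthProj U) ∘ₗ (LinearMap.id - orthProj U))) := by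
      rw [LinearMap.trace_comp_comm', orthProj_comp_self]
      simp only [LinearMap.comp_assoc]
    _ = LinearMap.trace ℂ V (LinearMap.adjoint f ∘ₗ orthProj U' ∘ₗ f) -
          LinearMap.trace ℂ V (LinearMap.adjoint f ∘ₗ f ∘ₗ orthProj U) := by
      rw [hP, ← orthProj_comp_comp_orthProj hf, ← map_sub]
      simp only [LinearMap.comp_sub, LinearMap.comp_id]
    _ = _ := by
      rw [LinearMap.trace_comp_comm', ← LinearMap.comp_assoc _ f,
        LinearMap.trace_comp_comm' (orthProj U)]
      simp only [LinearMap.comp_assoc]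

theorem map_orthogonal_of_secondFundamentalForm_eq_zero {f : V →ₗ[ℂ] W} {U : Submodule ℂ V}
    {U' : Submodule ℂ W} (hf : secondFundamentalForm f U U' = 0) {x : V} (hx : x ∈ Uᗮ) :
    f x ∈ U'ᗮ := by
  have hx0 : U.starProjection x = 0 := U.starProjection_apply_eq_zero_iff.2 hx
  have := LinearMap.congr_fun hf x
  refine U'.starProjection_apply_eq_zero_iff.1 ?_
  simpa [secondFundamentalForm, orthProj, hx0] using this

end Trace

theorem sum_trace_comp_vortexOp (P : ∀ v, E v →ₗ[ℂ] E v) :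
    ∑ v, LinearMap.trace ℂ (E v) (P v ∘ₗ vortexOp t h E φ v) =
      ∑ a, (LinearMap.trace ℂ (E (h a)) (P (h a) ∘ₗ φ a ∘ₗ LinearMap.adjoint (φ a)) -
        LinearMap.trace ℂ (E (t a)) (P (t a) ∘ₗ LinearMap.adjoint (φ a) ∘ₗ φ a)) := by
  have hcast : ∀ (v w : Q0) (f : E w →ₗ[ℂ] E w),
      LinearMap.trace ℂ (E v) (P v ∘ₗ (if hw : w = v then hw ▸ f else 0)) =
        if w = v then LinearMap.trace ℂ (E w) (P w ∘ₗ f) else 0 := by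
    intro v w f
    by_cases hw : w = v
    · subst hw
      simp
    · simp [hw]
  have htrace : ∀ v, LinearMap.trace ℂ (E v) (P v ∘ₗ vortexOp t h E φ v) =
      (∑ a, if h a = v then
        LinearMap.trace ℂ (E (h a)) (P (h a) ∘ₗ φ a ∘ₗ LinearMap.adjoint (φ a)) else 0) -
      ∑ a, if t a = v then
        LinearMap.trace ℂ (E (t a)) (P (t a) ∘ₗ LinearMap.adjoint (φ a) ∘ₗ φ a) else 0 := by
    intro v
    rw [vortexOp, ← Module.End.mul_eq_comp, mul_sub, Finset.mul_sum, Finset.mul_sum, map_sub,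
      map_sum, map_sum]
    simp only [Module.End.mul_eq_comp, hcast]
  simp only [htrace, Finset.sum_sub_distrib]
  congr 1 <;> rw [Finset.sum_comm] <;> simp

variable {t h E φ}

theorem degST_eq_neg_sum_trace {τ : Q0 → ℝ} (hvortex : SatisfiesVortex t h E φ τ)
    {U : ∀ v, Submodule ℂ (E v)} (hU : IsSubrep t h E φ U) :
    degST E τ U = -∑ a, (LinearMap.trace ℂ (E (t a))
      (LinearMap.adjoint (secondFundamentalForm (φ a) (U (t a)) (U (h a))) ∘ₗ
        secondFundamentalForm (φ a) (U (t a)) (U (h a)))).re := by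
  have hsum := sum_trace_comp_vortexOp t h E φ fun v => orthProj (U v)
  simp only [← trace_adjoint_comp_secondFundamentalForm (hU _), hvortex _, LinearMap.comp_smul,
    LinearMap.comp_id, map_smul, trace_orthProj] at hsum
  rw [degST, ← Complex.re_sum, ← hsum, Complex.re_sum]
  simp

theorem degST_top {τ : Q0 → ℝ} (hvortex : SatisfiesVortex t h E φ τ) :
    degST E τ (fun v => (⊤ : Submodule ℂ (E v))) = 0 := by
  rw [degST_eq_neg_sum_trace hvortex fun _ _ _ => Submodule.mem_top]
  have hzero : ∀ a, secondFundamentalForm (φ a) ⊤ ⊤ = 0 := fun a => by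
    ext x
    have hx : (⊤ : Submodule ℂ (E (t a))).starProjection x = x :=
      Submodule.starProjection_eq_self_iff.2 Submodule.mem_top
    simp [secondFundamentalForm, orthProj, hx]
  simp [hzero]

theorem degST_nonpos {τ : Q0 → ℝ} (hvortex : SatisfiesVortex t h E φ τ)
    {U : ∀ v, Submodule ℂ (E v)} (hU : IsSubrep t h E φ U) : degST E τ U ≤ 0 := by
  rw [degST_eq_neg_sum_trace hvortex hU, neg_nonpos]
  exact Finset.sum_nonneg fun _ _ => re_trace_adjoint_comp_self_nonneg _

theorem isSubrep_orthogonal_of_degST_eq_zero {τ : Q0 → ℝ} (hvortex : SatisfiesVortex t h E φ τ)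
    {U : ∀ v, Submodule ℂ (E v)} (hU : IsSubrep t h E φ U) (hdeg : degST E τ U = 0) :
    IsSubrep t h E φ fun v => (U v)ᗮ := by
  rw [degST_eq_neg_sum_trace hvortex hU, neg_eq_zero,
    Finset.sum_eq_zero_iff_of_nonneg fun _ _ => re_trace_adjoint_comp_self_nonneg _] at hdeg
  intro a x hx
  exact map_orthogonal_of_secondFundamentalForm_eq_zero
    (eq_zero_of_re_trace_adjoint_comp_self_eq_zero (hdeg a (Finset.mem_univ a))) hx

variable (t h E φ)

/-- A nonzero representation of a finite quiver whose inner products satisfy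
the (σ,τ)-vortex equations and which is indecomposable (admits no internal direct sum
decomposition into two nonzero subrepresentations) is (σ,τ)-stable. -/
theorem statement3 (σ τ : Q0 → ℝ) (hσ : ∀ v, 0 < σ v)
    (hnz : ∃ v, Module.finrank ℂ (E v) ≠ 0)
    (hvortex : SatisfiesVortex t h E φ τ)
    (hind : ¬ ∃ (U W : ∀ v, Submodule ℂ (E v)),
      IsSubrep t h E φ U ∧ IsSubrep t h E φ W ∧
      (∃ v, U v ≠ ⊥) ∧ (∃ v, W v ≠ ⊥) ∧ ∀ v, IsCompl (U v) (W v)) :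
    IsStable t h E φ σ τ := by
  intro U hU hne hproper
  have hdeg : degST E τ U < 0 := by
    refine lt_of_le_of_ne (degST_nonpos hvortex hU) fun hdeg => hind ?_
    obtain ⟨v, hv⟩ := hproper
    exact ⟨U, fun v => (U v)ᗮ, hU, isSubrep_orthogonal_of_degST_eq_zero hvortex hU hdeg, hne,
      ⟨v, fun hbot => hv (Submodule.orthogonal_eq_bot_iff.1 hbot)⟩,
      fun v => (U v).isCompl_orthogonal⟩
  rw [slopeST, slopeST, degST_top hvortex, zero_div]
  refine div_neg_of_neg_of_pos hdeg ?_
  obtain ⟨v, hv⟩ := hne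
  refine Finset.sum_pos' (fun w _ => by have := hσ w; positivity) ⟨v, Finset.mem_univ v, ?_⟩
  have hrank : 0 < Module.finrank ℂ (U v) :=
    Nat.pos_of_ne_zero fun h0 => hv (Submodule.finrank_eq_zero.1 h0)
  have := hσ v
  positivity
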